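/- arXiv:2303.10245 — 2 statements merged into one kernel-verified Lean document; each statement's English description precedes it below -/
import Mathlib

section
/- Let I ⊂ ℝ be an interval of finite positive length |I| > 0 and let f : I → ℝ be continuously differentiable. Then for every p ≥ 1, sup_{t∈I} |f(t)|^p ≤ (1/|I|) ∫_I |f(r)|^p dr + p ( ∫_I |f(r)|^p dr )^{(p−1)/p} ( ∫_I |f′(r)|^p dr )^{1/p}. -/
open Set

open MeasureTheory

theorem abs_sub_le_integral_of_abs_deriv_le {a b : ℝ} {g g' B : ℝ → ℝ}
    (hg : ∀ t ∈ Icc a b, HasDerivWithinAt g (g' t) (Icc a b) t)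
    (hB : ContinuousOn B (Icc a b)) (hgB : ∀ t ∈ Icc a b, |g' t| ≤ B t)
    {s t : ℝ} (hs : s ∈ Icc a b) (ht : t ∈ Icc a b) :
    |g t - g s| ≤ ∫ r in a..b, B r := by
  wlog hst : s ≤ t generalizing s t
  · rw [abs_sub_comm]
    exact this ht hs (le_of_not_ge hst)
  have hsub : Icc s t ⊆ Icc a b := Icc_subset_Icc hs.1 ht.2
  have hderiv : ∀ x ∈ Ioo s t, HasDerivAt g (g' x) x := fun x hx =>
    (hg x (hsub (Ioo_subset_Icc_self hx))).hasDerivAt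
      (Icc_mem_nhds (hs.1.trans_lt hx.1) (hx.2.trans_le ht.2))
  calc |g t - g s| ≤ ∫ r in s..t, B r := by
        refine norm_sub_le_integral_of_norm_deriv_le_of_le hst
          (fun x hx => (hg x (hsub hx)).continuousWithinAt.mono hsub)
          (fun x hx => (hderiv x hx).differentiableAt.differentiableWithinAt)
          (.of_forall fun x hx => ?_)
          ((hB.mono hsub).intervalIntegrable_of_Icc hst)
        rw [(hderiv x hx).deriv]
        exact hgB x (hsub (Ioo_subset_Icc_self hx))
    _ ≤ ∫ r in a..b, B r := by
        refine intervalIntegral.integral_mono_interval hs.1 hst ht.2 ?_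
          (hB.intervalIntegrable_of_Icc (hs.1.trans (hst.trans ht.2)))
        filter_upwards [ae_restrict_mem measurableSet_Ioc] with x hx
        exact (abs_nonneg _).trans (hgB x (Ioc_subset_Icc_self hx))

theorem ContinuousOn.memLp_restrict_Ioc {a b : ℝ} {g : ℝ → ℝ} (hg : ContinuousOn g (Icc a b))
    (q : ENNReal) : MemLp g q (volume.restrict (Ioc a b)) := by
  obtain ⟨C, hC⟩ := isCompact_Icc.exists_bound_of_continuousOn hg
  refine MemLp.of_bound
    ((hg.mono Ioc_subset_Icc_self).aestronglyMeasurable measurableSet_Ioc) C ?_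
  filter_upwards [ae_restrict_mem measurableSet_Ioc] with x hx
  exact hC x (Ioc_subset_Icc_self hx)

theorem integral_abs_rpow_mul_abs_le {a b : ℝ} (hab : a ≤ b) {f h : ℝ → ℝ}
    (hf : ContinuousOn f (Icc a b)) (hh : ContinuousOn h (Icc a b)) {p : ℝ} (hp : 1 < p) :
    ∫ r in a..b, |f r| ^ (p - 1) * |h r|
      ≤ (∫ r in a..b, |f r| ^ p) ^ ((p - 1) / p) * (∫ r in a..b, |h r| ^ p) ^ (1 / p) := by
  have hp0 : p - 1 ≠ 0 := (sub_pos.2 hp).ne'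
  have hconj := (Real.HolderConjugate.conjExponent hp).symm
  have hfp : ContinuousOn (fun r => |f r| ^ (p - 1)) (Icc a b) :=
    hf.abs.rpow_const fun _ _ => .inr (sub_pos.2 hp).le
  have key := integral_mul_le_Lp_mul_Lq_of_nonneg (μ := volume.restrict (Ioc a b)) hconj
    (.of_forall fun r => by positivity) (.of_forall fun r => abs_nonneg (h r))
    (hfp.memLp_restrict_Ioc _) (hh.abs.memLp_restrict_Ioc _)
  simp only [← Real.rpow_mul (abs_nonneg _), Real.conjExponent, mul_div_cancel₀ _ hp0,
    one_div_div] at key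
  simpa only [intervalIntegral.integral_of_le hab] using key

theorem abs_rpow_sub_abs_rpow_le {a b : ℝ} (hab : a ≤ b) {f f' : ℝ → ℝ}
    (hderiv : ∀ t ∈ Icc a b, HasDerivWithinAt f (f' t) (Icc a b) t)
    (hcont : ContinuousOn f' (Icc a b)) {p : ℝ} (hp : 1 ≤ p)
    {s t : ℝ} (hs : s ∈ Icc a b) (ht : t ∈ Icc a b) :
    |f t| ^ p - |f s| ^ p ≤ p * (∫ r in a..b, |f r| ^ p) ^ ((p - 1) / p)
      * (∫ r in a..b, |f' r| ^ p) ^ (1 / p) := by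
  obtain rfl | hp := hp.eq_or_lt
  · simpa using (abs_sub_abs_le_abs_sub _ _).trans
      (abs_sub_le_integral_of_abs_deriv_le hderiv hcont.abs (fun _ _ => le_rfl) hs ht)
  have hf : ContinuousOn f (Icc a b) := fun x hx => (hderiv x hx).continuousWithinAt
  have hfp : ContinuousOn (fun r => |f r| ^ (p - 1)) (Icc a b) :=
    hf.abs.rpow_const fun _ _ => .inr (sub_pos.2 hp).le
  have hbound : ∀ r, |p * |f r| ^ (p - 2) * f r * f' r| ≤ p * (|f r| ^ (p - 1) * |f' r|) := by
    intro r
    have hpow : |f r| ^ (p - 2) * |f r| = |f r| ^ (p - 1) := by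
      rw [← Real.rpow_add_one' (abs_nonneg _) (by linarith)]
      ring_nf
    rw [← hpow, abs_mul, abs_mul, abs_mul, abs_of_pos (zero_lt_one.trans hp),
      abs_of_nonneg (Real.rpow_nonneg (abs_nonneg _) _)]
    exact le_of_eq (by ring)
  have hsub := abs_sub_le_integral_of_abs_deriv_le
    (fun r hr => (hasDerivAt_abs_rpow (f r) hp).comp_hasDerivWithinAt r (hderiv r hr))
    ((hfp.mul hcont.abs).const_mul p) (fun r _ => hbound r) hs ht
  calc |f t| ^ p - |f s| ^ p ≤ ∫ r in a..b, p * (|f r| ^ (p - 1) * |f' r|) :=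
        (le_abs_self _).trans hsub
    _ = p * ∫ r in a..b, |f r| ^ (p - 1) * |f' r| := intervalIntegral.integral_const_mul _ _
    _ ≤ _ := by
        rw [mul_assoc]
        exact mul_le_mul_of_nonneg_left (integral_abs_rpow_mul_abs_le hab hf hcont hp)
          (zero_le_one.trans hp.le)

/-- **Sobolev-type lemma.** Let `f : I → ℝ` be `C¹` on an interval `I = [a,b]` of
positive length. Then for every `p ≥ 1`,
`sup_{t∈I} |f(t)|^p ≤ (1/|I|) ∫_I |f|^p + p (∫_I |f|^p)^{(p−1)/p} (∫_I |f'|^p)^{1/p}`. -/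
theorem sup_le_integral_add_deriv
    (a b : ℝ) (hab : a < b) (f f' : ℝ → ℝ)
    (hderiv : ∀ t ∈ Icc a b, HasDerivWithinAt f (f' t) (Icc a b) t)
    (hcont : ContinuousOn f' (Icc a b))
    (p : ℝ) (hp : 1 ≤ p) :
    (⨆ t : Icc a b, |f (t : ℝ)| ^ p)
      ≤ (1 / (b - a)) * ∫ r in a..b, |f r| ^ p
        + p * (∫ r in a..b, |f r| ^ p) ^ ((p - 1) / p)
            * (∫ r in a..b, |f' r| ^ p) ^ ((1 : ℝ) / p) := by
  have : Nonempty (Icc a b) := ⟨⟨a, left_mem_Icc.2 hab.le⟩⟩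
  have hfp : ContinuousOn (fun r => |f r| ^ p) (Icc a b) :=
    ContinuousOn.rpow_const (fun x hx => (hderiv x hx).continuousWithinAt.abs)
      fun _ _ => .inr (zero_le_one.trans hp)
  refine ciSup_le fun t => ?_
  rw [one_div_mul_eq_div, le_div_iff₀ (sub_pos.2 hab)]
  have hmono := intervalIntegral.integral_mono_on (μ := volume) hab.le
    (intervalIntegrable_const (c := |f t| ^ p))
    ((hfp.intervalIntegrable_of_Icc hab.le).add intervalIntegrable_const)
    fun s hs => sub_le_iff_le_add'.1 (abs_rpow_sub_abs_rpow_le hab.le hderiv hcont hp hs t.2)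
  simpa only [intervalIntegral.integral_const, smul_eq_mul, mul_comm (b - a)] using hmono
end

section
/- Fix d ∈ ℕ, a ∈ ℝ, an integer q ≥ 0 and constants 0 < C₁ < C₂. (i) Let 𝔢 ∈ (0,1], N := −⌊log₂ 𝔢⌋, and suppose K : ℝ^{d+1} → ℝ can be written as K = Σ_{n=0}^N K^{(n)}, where each K^{(n)} is smooth, supported in { z : C₁ 2^{−n} ≤ ‖z‖_𝔰 ≤ C₂ 2^{−n} }, and satisfies |D^k K^{(n)}(z)| ≤ C 2^{n(a+|k|_𝔰)} for all z ∈ ℝ^{d+1} and all multi-indices k with |k|_𝔰 ≤ q, for some C > 0. Then ‖K‖^{(𝔢)}_{a;q} := sup_{z∈ℝ^{d+1}} sup_{|k|_𝔰 ≤ q} (‖z‖_𝔰 + 𝔢)^{a+|k|_𝔰} |D^k K(z)| ≤ C′, where C′ depends only on C, C₁, C₂, a, q and d (in particular not on 𝔢). (ii) Conversely, if K : ℝ^{d+1} → ℝ is smooth, supported in { ‖z‖_𝔰 ≤ 1 }, and satisfies ‖K‖^{(𝔢)}_{a;q} ≤ C, then there exist constants 0 < c₁ < c₂ and C′ depending only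 on C, a, q, d, and smooth functions K^{(n)}, 0 ≤ n ≤ N, with K = Σ_{n=0}^N K^{(n)}, each K^{(n)} supported in { ‖z‖_𝔰 ≤ c₂ 2^{−n} } and, for n < N, in { c₁ 2^{−n} ≤ ‖z‖_𝔰 ≤ c₂ 2^{−n} }, and |D^k K^{(n)}(z)| ≤ C′ 2^{n(a+|k|_𝔰)} for all z and all |k|_𝔰 ≤ q. -/
open Set

noncomputable section

namespace ParabolicKernels

/-- The parabolic norm `‖z‖_𝔰 = |t|^{1/2} + |x|` on `ℝ^{d+1}`, where `z 0 = t` is the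
time variable and `(z 1, …, z d)` are the space variables. -/
def pnorm (d : ℕ) (z : Fin (d + 1) → ℝ) : ℝ :=
  Real.sqrt |z 0| + Real.sqrt (∑ i : Fin d, z i.succ ^ 2)

/-- The parabolic degree `|k|_𝔰 = 2 k₀ + Σ_{i=1}^d k_i` of a multi-index. -/
def pdeg (d : ℕ) (k : Fin (d + 1) → ℕ) : ℕ :=
  2 * k 0 + ∑ i : Fin d, k i.succ

/-- Partial derivative in the `i`-th coordinate. -/
def pderiv (d : ℕ) (i : Fin (d + 1)) (f : (Fin (d + 1) → ℝ) → ℝ) :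
    (Fin (d + 1) → ℝ) → ℝ :=
  fun z => deriv (fun s => f (Function.update z i s)) (z i)

/-- Iterated partial derivatives along a list of coordinates. -/
def mderivAux (d : ℕ) : List (Fin (d + 1)) → ((Fin (d + 1) → ℝ) → ℝ) →
    ((Fin (d + 1) → ℝ) → ℝ)
  | [], f => f
  | i :: is, f => pderiv d i (mderivAux d is f)

/-- The multi-derivative `D^k f` associated to a multi-index `k`. -/
def mderiv (d : ℕ) (k : Fin (d + 1) → ℕ) (f : (Fin (d + 1) → ℝ) → ℝ) :
    (Fin (d + 1) → ℝ) → ℝ :=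
  mderivAux d ((List.finRange (d + 1)).flatMap fun i => List.replicate (k i) i) f

end ParabolicKernels

open ParabolicKernels

namespace ParabolicKernels

open scoped ContDiff

/-- The parabolic weight of a list of coordinate directions. -/
def wdeg (d : ℕ) (l : List (Fin (d + 1))) : ℕ :=
  (l.map fun i => if i = 0 then 2 else 1).sum

/-- The parabolic dilation by the factor `c`. -/
def dil (d : ℕ) (c : ℝ) (z : Fin (d + 1) → ℝ) : Fin (d + 1) → ℝ :=
  fun i => c ^ (if i = 0 then 2 else 1) * z i

variable {d : ℕ}

lemma length_le_wdeg (l : List (Fin (d + 1))) : l.length ≤ wdeg d l := by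
  induction l with
  | nil => simp
  | cons i l ih =>
    simp only [wdeg, List.map_cons, List.sum_cons, List.length_cons] at ih ⊢
    split_ifs <;> omega

lemma wdeg_flatMap_replicate (k : Fin (d + 1) → ℕ) :
    wdeg d ((List.finRange (d + 1)).flatMap fun i => List.replicate (k i) i) = pdeg d k := by
  have h (L : List (Fin (d + 1))) : wdeg d (L.flatMap fun i => List.replicate (k i) i)
      = (L.map fun i => k i * if i = 0 then 2 else 1).sum := by
    induction L with
    | nil => simp [wdeg]
    | cons i L ih =>
      simp only [wdeg] at ih
      simp [wdeg, ih]
  rw [h, ← List.ofFn_eq_map, List.sum_ofFn, Fin.sum_univ_succ, pdeg]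
  simp [Fin.succ_ne_zero, mul_comm]

lemma exists_eq_flatMap_replicate_of_sublist {α : Type*} [DecidableEq α] {L : List α}
    (hL : L.Nodup) {k : α → ℕ} {l : List α}
    (h : l.Sublist (L.flatMap fun i => List.replicate (k i) i)) :
    ∃ j : α → ℕ, l = L.flatMap fun i => List.replicate (j i) i := by
  induction L generalizing l with
  | nil => exact ⟨k, by simpa using h⟩
  | cons i L ih =>
    rw [List.flatMap_cons, List.sublist_append_iff] at h
    obtain ⟨l₁, l₂, rfl, h₁, h₂⟩ := h
    obtain ⟨hi, hL⟩ := List.nodup_cons.1 hL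
    obtain ⟨j, rfl⟩ := ih hL h₂
    obtain ⟨m, -, rfl⟩ := List.sublist_replicate_iff.1 h₁
    refine ⟨Function.update j i m, ?_⟩
    rw [List.flatMap_cons, Function.update_self]
    congr 1
    refine List.flatMap_congr fun x hx => ?_
    rw [Function.update_of_ne (by rintro rfl; exact hi hx)]

lemma exists_mderiv_eq_of_sublist {k : Fin (d + 1) → ℕ} {l : List (Fin (d + 1))}
    (h : l.Sublist ((List.finRange (d + 1)).flatMap fun i => List.replicate (k i) i)) :
    ∃ j : Fin (d + 1) → ℕ, pdeg d j = wdeg d l ∧ ∀ f, mderivAux d l f = mderiv d j f := by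
  obtain ⟨j, rfl⟩ := exists_eq_flatMap_replicate_of_sublist (List.nodup_finRange _) h
  exact ⟨j, (wdeg_flatMap_replicate j).symm, fun _ => rfl⟩

lemma mderivAux_concat (l : List (Fin (d + 1))) (i : Fin (d + 1))
    (f : (Fin (d + 1) → ℝ) → ℝ) :
    mderivAux d (l ++ [i]) f = mderivAux d l (pderiv d i f) := by
  induction l with
  | nil => rfl
  | cons j l ih => simp only [List.cons_append, mderivAux, ih]

lemma pderiv_eq_fderiv {f : (Fin (d + 1) → ℝ) → ℝ} (hf : ContDiff ℝ ∞ f) (i : Fin (d + 1)) :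
    pderiv d i f = fun z => fderiv ℝ f z (Pi.single i 1) := by
  funext z
  have h1 : HasFDerivAt f (fderiv ℝ f z) (Function.update z i (z i)) := by
    rw [Function.update_eq_self]
    exact (hf.differentiable (by simp) z).hasFDerivAt
  exact (h1.comp_hasDerivAt (z i) (hasDerivAt_update z i (z i))).deriv

lemma contDiff_pderiv {f : (Fin (d + 1) → ℝ) → ℝ} (hf : ContDiff ℝ ∞ f) (i : Fin (d + 1)) :
    ContDiff ℝ ∞ (pderiv d i f) := by
  rw [pderiv_eq_fderiv hf]
  exact (hf.fderiv_right (by simp)).clm_apply contDiff_const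

lemma contDiff_mderivAux {f : (Fin (d + 1) → ℝ) → ℝ} (hf : ContDiff ℝ ∞ f)
    (l : List (Fin (d + 1))) : ContDiff ℝ ∞ (mderivAux d l f) := by
  induction l with
  | nil => exact hf
  | cons i l ih => exact contDiff_pderiv ih i

lemma tsupport_mderivAux_subset {f : (Fin (d + 1) → ℝ) → ℝ} (hf : ContDiff ℝ ∞ f)
    (l : List (Fin (d + 1))) : tsupport (mderivAux d l f) ⊆ tsupport f := by
  induction l with
  | nil => exact subset_rfl
  | cons i l ih =>
    refine Set.Subset.trans ?_ ih
    rw [mderivAux, pderiv_eq_fderiv (contDiff_mderivAux hf l)]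
    exact tsupport_fderiv_apply_subset ℝ _

lemma pderiv_add {f g : (Fin (d + 1) → ℝ) → ℝ} (hf : ContDiff ℝ ∞ f) (hg : ContDiff ℝ ∞ g)
    (i : Fin (d + 1)) :
    pderiv d i (fun z => f z + g z) = fun z => pderiv d i f z + pderiv d i g z := by
  rw [pderiv_eq_fderiv hf, pderiv_eq_fderiv hg, pderiv_eq_fderiv (hf.add hg)]
  funext z
  rw [fderiv_fun_add (hf.differentiable (by simp) z) (hg.differentiable (by simp) z)]
  rfl

lemma pderiv_mul {f g : (Fin (d + 1) → ℝ) → ℝ} (hf : ContDiff ℝ ∞ f) (hg : ContDiff ℝ ∞ g)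
    (i : Fin (d + 1)) :
    pderiv d i (fun z => f z * g z) = fun z => f z * pderiv d i g z + pderiv d i f z * g z := by
  rw [pderiv_eq_fderiv hf, pderiv_eq_fderiv hg, pderiv_eq_fderiv (hf.mul hg)]
  funext z
  rw [fderiv_fun_mul (hf.differentiable (by simp) z) (hg.differentiable (by simp) z)]
  simp [mul_comm]

lemma mderivAux_add {f g : (Fin (d + 1) → ℝ) → ℝ} (hf : ContDiff ℝ ∞ f) (hg : ContDiff ℝ ∞ g)
    (l : List (Fin (d + 1))) :
    mderivAux d l (fun z => f z + g z) = fun z => mderivAux d l f z + mderivAux d l g z := by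
  induction l with
  | nil => rfl
  | cons i l ih =>
    rw [mderivAux, ih, pderiv_add (contDiff_mderivAux hf l) (contDiff_mderivAux hg l)]
    rfl

lemma mderivAux_zero (l : List (Fin (d + 1))) : mderivAux d l (fun _ => 0) = fun _ => 0 := by
  induction l with
  | nil => rfl
  | cons i l ih =>
    rw [mderivAux, ih]
    funext z
    simp [pderiv]

lemma mderivAux_sum {ι : Type*} {s : Finset ι} {f : ι → (Fin (d + 1) → ℝ) → ℝ}
    (hf : ∀ n ∈ s, ContDiff ℝ ∞ (f n)) (l : List (Fin (d + 1))) :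
    mderivAux d l (fun z => ∑ n ∈ s, f n z) = fun z => ∑ n ∈ s, mderivAux d l (f n) z := by
  classical
  induction s using Finset.induction_on with
  | empty => simpa using mderivAux_zero l
  | insert n s hn ih =>
    have hs : ∀ m ∈ s, ContDiff ℝ ∞ (f m) := fun m hm => hf m (Finset.mem_insert_of_mem hm)
    simp only [Finset.sum_insert hn]
    rw [mderivAux_add (hf n (Finset.mem_insert_self n s)) (ContDiff.sum hs), ih hs]

/-- The Leibniz rule, as a bound on the derivatives of a product. -/
lemma abs_mderivAux_mul_le {f g : (Fin (d + 1) → ℝ) → ℝ} (hf : ContDiff ℝ ∞ f)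
    (hg : ContDiff ℝ ∞ g) (l : List (Fin (d + 1))) (z : Fin (d + 1) → ℝ) (B : ℝ)
    (h : ∀ l₁ l₂ : List (Fin (d + 1)), l₁.Sublist l → l₂.Sublist l →
      wdeg d l₁ + wdeg d l₂ = wdeg d l → |mderivAux d l₁ f z| * |mderivAux d l₂ g z| ≤ B) :
    |mderivAux d l (fun z => f z * g z) z| ≤ 2 ^ l.length * B := by
  induction l using List.reverseRecOn generalizing f g with
  | nil => simpa [mderivAux, abs_mul] using h [] [] (by simp) (by simp) (by simp [wdeg])
  | append_singleton l i ih =>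
    rw [mderivAux_concat, pderiv_mul hf hg, mderivAux_add (hf.mul (contDiff_pderiv hg i))
      ((contDiff_pderiv hf i).mul hg)]
    have hl : l.Sublist (l ++ [i]) := List.sublist_append_left l [i]
    have h1 := ih hf (contDiff_pderiv hg i) fun l₁ l₂ h₁ h₂ hw => by
      rw [← mderivAux_concat]
      refine h _ _ (h₁.trans hl) (h₂.append_right [i]) ?_
      simp only [wdeg, List.map_append, List.sum_append] at hw ⊢
      omega
    have h2 := ih (contDiff_pderiv hf i) hg fun l₁ l₂ h₁ h₂ hw => by
      rw [← mderivAux_concat]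
      refine h _ _ (h₁.append_right [i]) (h₂.trans hl) ?_
      simp only [wdeg, List.map_append, List.sum_append] at hw ⊢
      omega
    refine (abs_add_le _ _).trans ((add_le_add h1 h2).trans_eq ?_)
    simp [pow_succ]
    ring

lemma dil_update (c s : ℝ) (z : Fin (d + 1) → ℝ) (i : Fin (d + 1)) :
    dil d c (Function.update z i s)
      = Function.update (dil d c z) i (c ^ (if i = 0 then 2 else 1) * s) := by
  funext j
  by_cases hj : j = i
  · subst hj; simp [dil]
  · simp [dil, hj]

lemma mderivAux_comp_dil (c : ℝ) (f : (Fin (d + 1) → ℝ) → ℝ) (l : List (Fin (d + 1))) :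
    mderivAux d l (fun z => f (dil d c z))
      = fun z => c ^ wdeg d l * mderivAux d l f (dil d c z) := by
  induction l with
  | nil => simp [mderivAux, wdeg]
  | cons i l ih =>
    funext z
    rw [mderivAux, ih, pderiv]
    simp only [dil_update]
    rw [deriv_const_mul_field, deriv_comp_mul_left
      (c ^ (if i = 0 then 2 else 1)) (fun s => mderivAux d l f (Function.update (dil d c z) i s))]
    simp only [wdeg, List.map_cons, List.sum_cons, mderivAux, pderiv, smul_eq_mul, pow_add]
    simp only [dil]
    ring

lemma contDiff_dil (c : ℝ) : ContDiff ℝ ∞ (dil d c) := by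
  unfold dil
  fun_prop

lemma pnorm_dil {c : ℝ} (hc : 0 ≤ c) (z : Fin (d + 1) → ℝ) :
    pnorm d (dil d c z) = c * pnorm d z := by
  have h1 : √|dil d c z 0| = c * √|z 0| := by
    simp only [dil, if_true, abs_mul, abs_pow]
    rw [Real.sqrt_mul (by positivity), Real.sqrt_sq (abs_nonneg c), abs_of_nonneg hc]
  have h2 : √(∑ i : Fin d, dil d c z i.succ ^ 2) = c * √(∑ i : Fin d, z i.succ ^ 2) := by
    simp only [dil, Fin.succ_ne_zero, if_false, pow_one, mul_pow, ← Finset.mul_sum]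
    rw [Real.sqrt_mul (by positivity), Real.sqrt_sq hc]
  rw [pnorm, h1, h2, pnorm, mul_add]

lemma continuous_pnorm : Continuous (pnorm d) := by
  unfold pnorm
  fun_prop

lemma pnorm_nonneg (z : Fin (d + 1) → ℝ) : 0 ≤ pnorm d z := by
  unfold pnorm
  positivity

lemma norm_le_one_of_pnorm_le_one {z : Fin (d + 1) → ℝ} (h : pnorm d z ≤ 1) : ‖z‖ ≤ 1 := by
  have h0 := Real.sqrt_nonneg |z 0|
  have h1 := Real.sqrt_nonneg (∑ i : Fin d, z i.succ ^ 2)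
  unfold pnorm at h
  rw [pi_norm_le_iff_of_nonneg zero_le_one]
  intro i
  rw [Real.norm_eq_abs]
  refine Fin.cases ?_ (fun j => ?_) i
  · simpa using (Real.sqrt_le_iff.1 (by linarith : √|z 0| ≤ 1)).2
  · have h2 : ∑ i : Fin d, z i.succ ^ 2 ≤ 1 := by
      simpa using (Real.sqrt_le_iff.1 (by linarith : √(∑ i : Fin d, z i.succ ^ 2) ≤ 1)).2
    have h3 : z j.succ ^ 2 ≤ ∑ i : Fin d, z i.succ ^ 2 :=
      Finset.single_le_sum (f := fun i : Fin d => z i.succ ^ 2) (fun _ _ => sq_nonneg _)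
        (Finset.mem_univ j)
    exact (sq_le_one_iff_abs_le_one _).1 (h3.trans h2)

/-- A smooth cutoff for the parabolic unit ball. -/
lemma exists_cutoff (d : ℕ) : ∃ (φ : (Fin (d + 1) → ℝ) → ℝ) (R : ℝ), 1 < R ∧ ContDiff ℝ ∞ φ ∧
    HasCompactSupport φ ∧ (∀ z, pnorm d z ≤ 1 → φ z = 1) ∧ (∀ z, φ z ≠ 0 → pnorm d z ≤ R) := by
  let φ : ContDiffBump (0 : Fin (d + 1) → ℝ) := ⟨1, 2, one_pos, one_lt_two⟩
  obtain ⟨R, hR⟩ := (φ.hasCompactSupport.isCompact.image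
    (continuous_pnorm (d := d))).isBounded.bddAbove
  refine ⟨φ, max R 2, by simp, φ.contDiff, φ.hasCompactSupport, fun z hz => ?_, fun z hz => ?_⟩
  · exact φ.one_of_mem_closedBall (by simpa [φ] using norm_le_one_of_pnorm_le_one hz)
  · exact (hR ⟨z, subset_tsupport _ hz, rfl⟩).trans (le_max_left _ _)

lemma norm_le_norm_dil {c : ℝ} (hc : 1 ≤ c) (z : Fin (d + 1) → ℝ) : ‖z‖ ≤ ‖dil d c z‖ := by
  refine (pi_norm_le_iff_of_nonneg (norm_nonneg _)).2 fun i => ?_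
  refine le_trans ?_ (norm_le_pi_norm (dil d c z) i)
  rw [dil, norm_mul]
  exact le_mul_of_one_le_left (norm_nonneg _) ((one_le_pow₀ hc).trans (Real.le_norm_self _))

lemma hasCompactSupport_comp_dil {c : ℝ} (hc : 1 ≤ c) {f : (Fin (d + 1) → ℝ) → ℝ}
    (hf : HasCompactSupport f) : HasCompactSupport fun z => f (dil d c z) := by
  obtain ⟨r, hr⟩ := hf.isCompact.isBounded.subset_closedBall 0
  refine HasCompactSupport.intro (isCompact_closedBall 0 r) fun z hz => ?_
  by_contra h
  have := hr (subset_tsupport _ h)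
  rw [mem_closedBall_zero_iff] at this hz
  exact hz ((norm_le_norm_dil hc z).trans this)

/-- Derivatives of bounded order of a test function are uniformly bounded. -/
lemma exists_bound_mderivAux {f : (Fin (d + 1) → ℝ) → ℝ} (hf : ContDiff ℝ ∞ f)
    (hs : HasCompactSupport f) (q : ℕ) :
    ∃ M : ℝ, 0 ≤ M ∧ ∀ l : List (Fin (d + 1)), wdeg d l ≤ q → ∀ z, |mderivAux d l f z| ≤ M := by
  have h (l : List (Fin (d + 1))) : ∃ M : ℝ, ∀ z, ‖mderivAux d l f z‖ ≤ M :=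
    HasCompactSupport.exists_bound_of_continuous
      (IsCompact.of_isClosed_subset hs (isClosed_tsupport _) (tsupport_mderivAux_subset hf l))
      (contDiff_mderivAux hf l).continuous
  choose M hM using h
  obtain ⟨B, hB⟩ := ((List.finite_length_le (Fin (d + 1)) q).image M).bddAbove
  refine ⟨max B 0, le_max_right _ _, fun l hl z => ?_⟩
  exact (hM l z).trans ((hB ⟨l, (length_le_wdeg l).trans hl, rfl⟩).trans (le_max_left _ _))

lemma rpow_le_of_mem_Icc {lo hi s R : ℝ} (hlo : 0 < lo) (hhi : 0 < hi) (hs : 0 < s)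
    (h1 : lo * s ≤ R) (h2 : R ≤ hi * s) (b : ℝ) : R ^ b ≤ (lo ^ b + hi ^ b) * s ^ b := by
  rw [add_mul, ← Real.mul_rpow hlo.le hs.le, ← Real.mul_rpow hhi.le hs.le]
  have hR : 0 < R := (mul_pos hlo hs).trans_le h1
  rcases le_total 0 b with hb | hb
  · have := Real.rpow_le_rpow hR.le h2 hb
    have : 0 ≤ (lo * s) ^ b := by positivity
    linarith
  · have := Real.rpow_le_rpow_of_nonpos (mul_pos hlo hs) h1 hb
    have : 0 ≤ (hi * s) ^ b := by positivity
    linarith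

lemma scale_bounds {e : ℝ} (he : 0 < e) {N : ℕ} (hN : (N : ℤ) = -⌊Real.logb 2 e⌋) :
    (2 : ℝ) ^ (-(N : ℝ)) ≤ e ∧ e ≤ 2 * 2 ^ (-(N : ℝ)) := by
  have h : ((⌊Real.logb 2 e⌋ : ℤ) : ℝ) = -(N : ℝ) := by
    have : ⌊Real.logb 2 e⌋ = -(N : ℤ) := by omega
    rw [this]; push_cast; rfl
  have h1 := Int.floor_le (Real.logb 2 e)
  have h2 := (Int.lt_floor_add_one (Real.logb 2 e)).le
  rw [h] at h1 h2
  refine ⟨(Real.le_logb_iff_rpow_le one_lt_two he).1 h1, ?_⟩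
  have := (Real.logb_le_iff_le_rpow one_lt_two he).1 h2
  rw [Real.rpow_add two_pos, Real.rpow_one] at this
  linarith

lemma two_rpow_neg_anti {m n : ℕ} (h : m ≤ n) : (2 : ℝ) ^ (-(n : ℝ)) ≤ 2 ^ (-(m : ℝ)) :=
  Real.rpow_le_rpow_of_exponent_le one_le_two (by simpa using h)

lemma add_le_scale {r e c : ℝ} {n N : ℕ} (hn : n ≤ N) (he : e ≤ 2 * 2 ^ (-(N : ℝ)))
    (hr : r ≤ c * 2 ^ (-(n : ℝ))) : r + e ≤ (c + 2) * 2 ^ (-(n : ℝ)) := by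
  have := two_rpow_neg_anti hn
  linarith

lemma card_scales_le {C₁ C₂ r : ℝ} (h₁ : 0 < C₁) {M : ℕ} (hM : C₂ / C₁ ≤ 2 ^ M)
    (s : Finset ℕ)
    (hs : ∀ n ∈ s, C₁ * 2 ^ (-(n : ℝ)) ≤ r ∧ r ≤ C₂ * 2 ^ (-(n : ℝ))) : s.card ≤ M + 1 := by
  rcases s.eq_empty_or_nonempty with rfl | hne
  · simp
  have hsub : s ⊆ Finset.Icc (s.min' hne) (s.min' hne + M) := by
    intro n hn
    refine Finset.mem_Icc.2 ⟨s.min'_le n hn, ?_⟩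
    set m := s.min' hne
    have hm := (hs m (s.min'_mem hne)).1
    have hn' := (hs n hn).2
    have hC : C₂ ≤ C₁ * 2 ^ M := by
      rw [div_le_iff₀ h₁] at hM; linarith
    have h2 : C₁ * (2 : ℝ) ^ (-(m : ℝ)) ≤ C₁ * 2 ^ ((M : ℝ) + -(n : ℝ)) := by
      rw [Real.rpow_add two_pos, Real.rpow_natCast, ← mul_assoc]
      exact hm.trans (hn'.trans (by gcongr))
    have h3 := (Real.rpow_le_rpow_left_iff one_lt_two).1 (le_of_mul_le_mul_left h2 h₁)
    have h4 : (n : ℝ) ≤ m + M := by linarith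
    exact_mod_cast h4
  refine (Finset.card_le_card hsub).trans ?_
  rw [Nat.card_Icc]
  omega

/-- The constant controlling all powers of order up to `q` on the annulus with radii `lo`, `hi`. -/
def powConst (lo hi : ℝ) (b : ℕ → ℝ) (q : ℕ) : ℝ :=
  ∑ m ∈ Finset.range (q + 1), (lo ^ b m + hi ^ b m)

lemma powConst_pos {lo hi : ℝ} (hlo : 0 < lo) (hhi : 0 < hi) (b : ℕ → ℝ) (q : ℕ) :
    0 < powConst lo hi b q :=
  Finset.sum_pos (fun _ _ => by positivity) ⟨0, by simp⟩

lemma rpow_le_powConst {lo hi s R : ℝ} (hlo : 0 < lo) (hhi : 0 < hi) (hs : 0 < s)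
    (h1 : lo * s ≤ R) (h2 : R ≤ hi * s) (b : ℕ → ℝ) {m q : ℕ} (hm : m ≤ q) :
    R ^ b m ≤ powConst lo hi b q * s ^ b m := by
  refine (rpow_le_of_mem_Icc hlo hhi hs h1 h2 (b m)).trans ?_
  gcongr
  exact Finset.single_le_sum (f := fun m => lo ^ b m + hi ^ b m)
    (fun _ _ => by positivity) (Finset.mem_range.2 (by omega))

lemma rpow_neg_natCast_rpow (n : ℕ) (b : ℝ) :
    ((2 : ℝ) ^ (-(n : ℝ))) ^ b * 2 ^ ((n : ℝ) * b) = 1 := by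
  rw [← Real.rpow_mul two_pos.le, ← Real.rpow_add two_pos]
  simp

lemma weighted_bound_of_decomposition (a : ℝ) (q : ℕ) {C₁ C₂ C : ℝ} (h₁ : 0 < C₁)
    (h₂ : 0 < C₂) (hC : 0 < C) {M : ℕ} (hM : C₂ / C₁ ≤ 2 ^ M)
    {e : ℝ} (he : 0 < e) {N : ℕ} (hN : (N : ℤ) = -⌊Real.logb 2 e⌋)
    {f : ℕ → (Fin (d + 1) → ℝ) → ℝ} (hf : ∀ n ≤ N, ContDiff ℝ ∞ (f n))
    (hsupp : ∀ n ≤ N, ∀ z, f n z ≠ 0 →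
      C₁ * 2 ^ (-(n : ℝ)) ≤ pnorm d z ∧ pnorm d z ≤ C₂ * 2 ^ (-(n : ℝ)))
    (hbd : ∀ n ≤ N, ∀ z (k : Fin (d + 1) → ℕ), pdeg d k ≤ q →
      |mderiv d k (f n) z| ≤ C * 2 ^ ((n : ℝ) * (a + (pdeg d k : ℝ))))
    (z : Fin (d + 1) → ℝ) (k : Fin (d + 1) → ℕ) (hk : pdeg d k ≤ q) :
    (pnorm d z + e) ^ (a + (pdeg d k : ℝ))
        * |mderiv d k (fun z => ∑ n ∈ Finset.range (N + 1), f n z) z|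
      ≤ (M + 1 : ℕ) * (powConst C₁ (C₂ + 2) (fun m => a + m) q * C) := by
  classical
  obtain ⟨-, he2⟩ := scale_bounds he hN
  have hP := powConst_pos h₁ (by linarith : 0 < C₂ + 2) (fun m => a + m) q
  have hlt {n : ℕ} (hn : n ∈ Finset.range (N + 1)) : n ≤ N := by
    have := Finset.mem_range.1 hn; omega
  have hsupp' (n : ℕ) (hn : n ≤ N) (hz : mderiv d k (f n) z ≠ 0) :
      C₁ * 2 ^ (-(n : ℝ)) ≤ pnorm d z ∧ pnorm d z ≤ C₂ * 2 ^ (-(n : ℝ)) := by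
    have hcl : IsClosed {z | C₁ * 2 ^ (-(n : ℝ)) ≤ pnorm d z ∧ pnorm d z ≤ C₂ * 2 ^ (-(n : ℝ))} :=
      (isClosed_le continuous_const continuous_pnorm).inter
        (isClosed_le continuous_pnorm continuous_const)
    exact closure_minimal (hsupp n hn) hcl
      (tsupport_mderivAux_subset (hf n hn) _ (subset_tsupport _ hz))
  have hterm (n : ℕ) (hn : n ≤ N) (hz : mderiv d k (f n) z ≠ 0) :
      (pnorm d z + e) ^ (a + (pdeg d k : ℝ)) * |mderiv d k (f n) z|
        ≤ powConst C₁ (C₂ + 2) (fun m => a + m) q * C := by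
    obtain ⟨hlo, hhi⟩ := hsupp' n hn hz
    have h := rpow_le_powConst h₁ (by linarith : 0 < C₂ + 2)
      (Real.rpow_pos_of_pos two_pos (-(n : ℝ))) (hlo.trans (by linarith))
      (add_le_scale hn he2 hhi) (fun m => a + m) hk
    refine (mul_le_mul h (hbd n hn z k hk) (abs_nonneg _) (by positivity)).trans_eq ?_
    linear_combination (powConst C₁ (C₂ + 2) (fun m => a + m) q * C)
      * rpow_neg_natCast_rpow n (a + pdeg d k)
  have hsum : mderiv d k (fun z => ∑ n ∈ Finset.range (N + 1), f n z) z
      = ∑ n ∈ Finset.range (N + 1) with mderiv d k (f n) z ≠ 0, mderiv d k (f n) z := by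
    rw [Finset.sum_filter_ne_zero]
    exact congrFun (mderivAux_sum (fun n hn => hf n (hlt hn)) _) z
  have hR : 0 ≤ pnorm d z + e := add_nonneg (pnorm_nonneg z) he.le
  rw [hsum]
  refine (mul_le_mul_of_nonneg_left (Finset.abs_sum_le_sum_abs _ _)
    (Real.rpow_nonneg hR _)).trans ?_
  rw [Finset.mul_sum]
  refine (Finset.sum_le_card_nsmul _ _ (powConst C₁ (C₂ + 2) (fun m => a + m) q * C)
    fun n hn => ?_).trans ?_
  · rw [Finset.mem_filter] at hn
    exact hterm n (hlt hn.1) hn.2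
  · rw [nsmul_eq_mul]
    gcongr
    refine card_scales_le (r := pnorm d z) h₁ hM _ fun n hn => ?_
    rw [Finset.mem_filter] at hn
    exact hsupp' n (hlt hn.1) hn.2

/-- Multiplying a kernel by a dilated cutoff localises it at the corresponding scale. -/
lemma abs_mderiv_cutoff_mul_le (a : ℝ) {q : ℕ} {C M lo hi e : ℝ} (hC : 0 < C) (hM : 0 ≤ M)
    (hlo : 0 < lo) (hhi : 0 < hi) {χ K : (Fin (d + 1) → ℝ) → ℝ} (hχ : ContDiff ℝ ∞ χ)
    (hK : ContDiff ℝ ∞ K)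
    (hχM : ∀ l : List (Fin (d + 1)), wdeg d l ≤ q → ∀ z, |mderivAux d l χ z| ≤ M)
    (hKC : ∀ z (k : Fin (d + 1) → ℕ), pdeg d k ≤ q →
      (pnorm d z + e) ^ (a + (pdeg d k : ℝ)) * |mderiv d k K z| ≤ C) (n : ℕ)
    (hsupp : ∀ z, χ (dil d (2 ^ n) z) ≠ 0 →
      lo * 2 ^ (-(n : ℝ)) ≤ pnorm d z + e ∧ pnorm d z + e ≤ hi * 2 ^ (-(n : ℝ)))
    (z : Fin (d + 1) → ℝ) (k : Fin (d + 1) → ℕ) (hk : pdeg d k ≤ q) :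
    |mderiv d k (fun z => χ (dil d (2 ^ n) z) * K z) z|
      ≤ 2 ^ q * (M * (C * powConst lo hi (fun m => -(a + m)) q))
        * 2 ^ ((n : ℝ) * (a + (pdeg d k : ℝ))) := by
  set P := powConst lo hi (fun m => -(a + m)) q
  have hP : 0 < P := powConst_pos hlo hhi _ q
  have hχn : ContDiff ℝ ∞ fun z => χ (dil d (2 ^ n) z) := hχ.comp (contDiff_dil _)
  rcases eq_or_ne (mderiv d k (fun z => χ (dil d (2 ^ n) z) * K z) z) 0 with h0 | h0
  · rw [h0, abs_zero]; positivity
  have hz : lo * 2 ^ (-(n : ℝ)) ≤ pnorm d z + e ∧ pnorm d z + e ≤ hi * 2 ^ (-(n : ℝ)) := by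
    have hcl : IsClosed {z | lo * 2 ^ (-(n : ℝ)) ≤ pnorm d z + e ∧
        pnorm d z + e ≤ hi * 2 ^ (-(n : ℝ))} :=
      (isClosed_le continuous_const (continuous_pnorm.add continuous_const)).inter
        (isClosed_le (continuous_pnorm.add continuous_const) continuous_const)
    refine closure_minimal ?_ hcl
      (tsupport_mderivAux_subset (hχn.mul hK) _ (subset_tsupport _ h0))
    exact fun y hy => hsupp y (left_ne_zero_of_mul hy)
  have hs : 0 < (2 : ℝ) ^ (-(n : ℝ)) := by positivity
  have hR : 0 < pnorm d z + e := (mul_pos hlo hs).trans_le hz.1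
  have hlen := length_le_wdeg ((List.finRange (d + 1)).flatMap fun i => List.replicate (k i) i)
  rw [wdeg_flatMap_replicate] at hlen
  refine (abs_mderivAux_mul_le hχn hK _ z
    (M * (C * P) * 2 ^ ((n : ℝ) * (a + (pdeg d k : ℝ)))) fun l₁ l₂ _ hl₂ hw => ?_).trans ?_
  · rw [wdeg_flatMap_replicate] at hw
    obtain ⟨j, hj, hjeq⟩ := exists_mderiv_eq_of_sublist hl₂
    rw [← hj] at hw
    rw [hjeq, mderivAux_comp_dil, abs_mul, abs_of_nonneg (by positivity)]
    have hKz : |mderiv d j K z| ≤ C * (P * 2 ^ ((n : ℝ) * (a + pdeg d j))) := by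
      have h1 := rpow_le_powConst hlo hhi hs hz.1 hz.2 (fun m => -(a + m))
        (show pdeg d j ≤ q by omega)
      have h2 : ((2 : ℝ) ^ (-(n : ℝ))) ^ (-(a + (pdeg d j : ℝ)))
          = 2 ^ ((n : ℝ) * (a + pdeg d j)) := by
        rw [← Real.rpow_mul two_pos.le]; congr 1; ring
      simp only [h2] at h1
      refine le_trans ?_ (mul_le_mul_of_nonneg_left h1 hC.le)
      rw [Real.rpow_neg hR.le, ← div_eq_mul_inv, le_div_iff₀ (by positivity), mul_comm]
      exact hKC z j (by omega)
    have hpow : (2 : ℝ) ^ ((n : ℝ) * (a + (pdeg d k : ℝ)))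
        = (2 ^ n) ^ wdeg d l₁ * 2 ^ ((n : ℝ) * (a + pdeg d j)) := by
      rw [← hw, ← pow_mul, ← Real.rpow_natCast, ← Real.rpow_add two_pos]
      congr 1
      push_cast
      ring
    refine (mul_le_mul (mul_le_mul_of_nonneg_left (hχM l₁ (by omega) _) (by positivity)) hKz
      (abs_nonneg _) (by positivity)).trans_eq ?_
    rw [hpow]
    ring
  · rw [← mul_assoc]
    gcongr
    · exact one_le_two
    · omega

lemma dil_two_pow_succ (n : ℕ) (z : Fin (d + 1) → ℝ) :
    dil d (2 ^ (n + 1)) z = dil d 2 (dil d (2 ^ n) z) := by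
  funext i
  simp only [dil, pow_succ, mul_pow]
  ring

lemma pnorm_dil_two_pow (n : ℕ) (z : Fin (d + 1) → ℝ) :
    pnorm d z = pnorm d (dil d (2 ^ n) z) * 2 ^ (-(n : ℝ)) := by
  rw [pnorm_dil (by positivity), Real.rpow_neg two_pos.le, Real.rpow_natCast]
  field_simp

lemma sum_cutoffs (φ : (Fin (d + 1) → ℝ) → ℝ) (N : ℕ) (z : Fin (d + 1) → ℝ) :
    ∑ n ∈ Finset.range (N + 1), (if n < N then fun y => φ y - φ (dil d 2 y) else φ)
      (dil d (2 ^ n) z) = φ z := by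
  rw [Finset.sum_range_succ, if_neg (lt_irrefl N)]
  have h : ∀ n ∈ Finset.range N, (if n < N then fun y => φ y - φ (dil d 2 y) else φ)
      (dil d (2 ^ n) z) = φ (dil d (2 ^ n) z) - φ (dil d (2 ^ (n + 1)) z) := fun n hn => by
    rw [if_pos (Finset.mem_range.1 hn), dil_two_pow_succ]
  rw [Finset.sum_congr rfl h, Finset.sum_range_sub' fun n => φ (dil d (2 ^ n) z)]
  have h1 : dil d (2 ^ 0) z = z := by
    funext i
    simp [dil]
  rw [sub_add_cancel, h1]

lemma exists_decomposition (d : ℕ) (a : ℝ) (q : ℕ) {C : ℝ} (hC : 0 < C) :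
    ∃ R C' : ℝ, 1 < R ∧ 0 < C' ∧ ∀ {e : ℝ}, 0 < e → ∀ {N : ℕ}, (N : ℤ) = -⌊Real.logb 2 e⌋ →
      ∀ {K : (Fin (d + 1) → ℝ) → ℝ}, ContDiff ℝ ∞ K → (∀ z, K z ≠ 0 → pnorm d z ≤ 1) →
      (∀ z (k : Fin (d + 1) → ℕ), pdeg d k ≤ q →
        (pnorm d z + e) ^ (a + (pdeg d k : ℝ)) * |mderiv d k K z| ≤ C) →
      ∃ f : ℕ → (Fin (d + 1) → ℝ) → ℝ,
        (∀ n, ContDiff ℝ ∞ (f n)) ∧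
        (∀ z, K z = ∑ n ∈ Finset.range (N + 1), f n z) ∧
        (∀ n z, f n z ≠ 0 → pnorm d z ≤ R * 2 ^ (-(n : ℝ))) ∧
        (∀ n < N, ∀ z, f n z ≠ 0 → 1 / 2 * 2 ^ (-(n : ℝ)) ≤ pnorm d z) ∧
        (∀ n ≤ N, ∀ z (k : Fin (d + 1) → ℕ), pdeg d k ≤ q →
          |mderiv d k (f n) z| ≤ C' * 2 ^ ((n : ℝ) * (a + (pdeg d k : ℝ)))) := by
  obtain ⟨φ, R, hR, hφ, hφs, hφ1, hφR⟩ := exists_cutoff d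
  set ψ : (Fin (d + 1) → ℝ) → ℝ := fun y => φ y - φ (dil d 2 y) with hψdef
  have hψ : ContDiff ℝ ∞ ψ := hφ.sub (hφ.comp (contDiff_dil 2))
  have hψs : HasCompactSupport ψ := hφs.sub (hasCompactSupport_comp_dil one_le_two hφs)
  obtain ⟨M₁, hM₁, hφM⟩ := exists_bound_mderivAux hφ hφs q
  obtain ⟨M₂, -, hψM⟩ := exists_bound_mderivAux hψ hψs q
  have hψR (z) (hz : ψ z ≠ 0) : pnorm d z ≤ R := by
    contrapose! hz
    have h0 {y} (hy : R < pnorm d y) : φ y = 0 := by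
      by_contra h
      exact (hφR y h).not_gt hy
    have h2 : R < pnorm d (dil d 2 z) := by
      rw [pnorm_dil two_pos.le]
      linarith
    simp [hψdef, h0 hz, h0 h2]
  have hψlo (z) (hz : ψ z ≠ 0) : 1 / 2 ≤ pnorm d z := by
    contrapose! hz
    have h2 : pnorm d (dil d 2 z) ≤ 1 := by
      rw [pnorm_dil two_pos.le]
      linarith
    simp [hψdef, hφ1 z (by linarith), hφ1 _ h2]
  set M := max M₁ M₂
  have hM : 0 ≤ M := hM₁.trans (le_max_left _ _)
  have hP := powConst_pos one_half_pos (by linarith : 0 < R + 2) (fun m => -(a + m)) q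
  refine ⟨R, 2 ^ q * (M * (C * powConst (1 / 2) (R + 2) (fun m => -(a + m)) q)) + 1, hR,
    by positivity, ?_⟩
  intro e he N hN K hK hKs hKC
  obtain ⟨he1, he2⟩ := scale_bounds he hN
  set χ : ℕ → (Fin (d + 1) → ℝ) → ℝ := fun n => if n < N then ψ else φ with hχdef
  have hχ (n) : ContDiff ℝ ∞ (χ n) := by
    simp only [hχdef]; split_ifs <;> assumption
  have hχM (n) (l : List (Fin (d + 1))) (hl : wdeg d l ≤ q) (z) : |mderivAux d l (χ n) z| ≤ M := by
    simp only [hχdef]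
    split_ifs
    · exact (hψM l hl z).trans (le_max_right _ _)
    · exact (hφM l hl z).trans (le_max_left _ _)
  have hχR (n z) (hz : χ n (dil d (2 ^ n) z) ≠ 0) : pnorm d z ≤ R * 2 ^ (-(n : ℝ)) := by
    rw [pnorm_dil_two_pow n]
    gcongr
    simp only [hχdef] at hz
    split_ifs at hz
    · exact hψR _ hz
    · exact hφR _ hz
  have hχlo (n) (hn : n < N) (z) (hz : χ n (dil d (2 ^ n) z) ≠ 0) :
      1 / 2 * 2 ^ (-(n : ℝ)) ≤ pnorm d z := by
    rw [pnorm_dil_two_pow n]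
    gcongr
    simp only [hχdef, if_pos hn] at hz
    exact hψlo _ hz
  refine ⟨fun n z => χ n (dil d (2 ^ n) z) * K z, fun n => ((hχ n).comp (contDiff_dil _)).mul hK,
    fun z => ?_, fun n z hz => hχR n z (left_ne_zero_of_mul hz),
    fun n hn z hz => hχlo n hn z (left_ne_zero_of_mul hz), fun n hn z k hk => ?_⟩
  · rw [← Finset.sum_mul, sum_cutoffs]
    by_cases hz : K z = 0
    · simp [hz]
    · rw [hφ1 z (hKs z hz), one_mul]
  · refine (abs_mderiv_cutoff_mul_le a hC hM one_half_pos (by linarith : 0 < R + 2) (hχ n) hK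
      (hχM n) hKC n (fun y hy => ⟨?_, add_le_scale hn he2 (hχR n y hy)⟩) z k hk).trans ?_
    · have hy0 := pnorm_nonneg y
      rcases hn.lt_or_eq with hn | rfl
      · linarith [hχlo n hn y hy]
      · have : 0 < (2 : ℝ) ^ (-(n : ℝ)) := by positivity
        linarith
    · gcongr
      linarith

end ParabolicKernels

/-- **Lemma (multiscale decomposition and the norm `‖·‖^{(𝔢)}_{a;q}`).**
(i) If `K = Σ_{n=0}^N K^{(n)}` with `N = −⌊log₂ 𝔢⌋`, each `K^{(n)}` smooth, supported in
`{C₁ 2^{−n} ≤ ‖z‖_𝔰 ≤ C₂ 2^{−n}}` and satisfying `|D^k K^{(n)}(z)| ≤ C 2^{n(a+|k|_𝔰)}`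
for `|k|_𝔰 ≤ q`, then `‖K‖^{(𝔢)}_{a;q} = sup_z sup_{|k|_𝔰 ≤ q} (‖z‖_𝔰+𝔢)^{a+|k|_𝔰}|D^k K(z)|`
is bounded by a constant `C′` depending only on `C, C₁, C₂, a, q, d` (not on `𝔢`).
(ii) Conversely, a smooth kernel `K` supported in `{‖z‖_𝔰 ≤ 1}` with `‖K‖^{(𝔢)}_{a;q} ≤ C`
admits such a decomposition with constants `c₁ < c₂` and `C′` depending only on
`C, a, q, d`. -/
theorem kernel_norm_iff_multiscale_decomposition (d : ℕ) (a : ℝ) (q : ℕ) :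
    -- (i)
    (∀ C₁ C₂ C : ℝ, 0 < C₁ → C₁ < C₂ → 0 < C →
      ∃ C' : ℝ, 0 < C' ∧
        ∀ (𝔢 : ℝ), 𝔢 ∈ Ioc (0:ℝ) 1 → ∀ N : ℕ, (N : ℤ) = -⌊Real.logb 2 𝔢⌋ →
        ∀ (Kker : (Fin (d + 1) → ℝ) → ℝ) (Kn : ℕ → (Fin (d + 1) → ℝ) → ℝ),
          (∀ z, Kker z = ∑ n ∈ Finset.range (N + 1), Kn n z) →
          (∀ n ≤ N, ContDiff ℝ (⊤ : ℕ∞) (Kn n)) →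
          (∀ n ≤ N, ∀ z, Kn n z ≠ 0 →
            C₁ * 2 ^ (-(n : ℝ)) ≤ pnorm d z ∧ pnorm d z ≤ C₂ * 2 ^ (-(n : ℝ))) →
          (∀ n ≤ N, ∀ (z) (k : Fin (d + 1) → ℕ), pdeg d k ≤ q →
            |mderiv d k (Kn n) z| ≤ C * 2 ^ ((n : ℝ) * (a + (pdeg d k : ℝ)))) →
          ∀ (z) (k : Fin (d + 1) → ℕ), pdeg d k ≤ q →
            (pnorm d z + 𝔢) ^ (a + (pdeg d k : ℝ)) * |mderiv d k Kker z| ≤ C')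
    ∧
    -- (ii)
    (∀ C : ℝ, 0 < C →
      ∃ c₁ c₂ C' : ℝ, 0 < c₁ ∧ c₁ < c₂ ∧ 0 < C' ∧
        ∀ (𝔢 : ℝ), 𝔢 ∈ Ioc (0:ℝ) 1 → ∀ N : ℕ, (N : ℤ) = -⌊Real.logb 2 𝔢⌋ →
        ∀ Kker : (Fin (d + 1) → ℝ) → ℝ,
          ContDiff ℝ (⊤ : ℕ∞) Kker →
          (∀ z, Kker z ≠ 0 → pnorm d z ≤ 1) →
          (∀ (z) (k : Fin (d + 1) → ℕ), pdeg d k ≤ q →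
            (pnorm d z + 𝔢) ^ (a + (pdeg d k : ℝ)) * |mderiv d k Kker z| ≤ C) →
          ∃ Kn : ℕ → (Fin (d + 1) → ℝ) → ℝ,
            (∀ n ≤ N, ContDiff ℝ (⊤ : ℕ∞) (Kn n)) ∧
            (∀ z, Kker z = ∑ n ∈ Finset.range (N + 1), Kn n z) ∧
            (∀ n ≤ N, ∀ z, Kn n z ≠ 0 → pnorm d z ≤ c₂ * 2 ^ (-(n : ℝ))) ∧
            (∀ n < N, ∀ z, Kn n z ≠ 0 → c₁ * 2 ^ (-(n : ℝ)) ≤ pnorm d z) ∧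
            (∀ n ≤ N, ∀ (z) (k : Fin (d + 1) → ℕ), pdeg d k ≤ q →
              |mderiv d k (Kn n) z| ≤ C' * 2 ^ ((n : ℝ) * (a + (pdeg d k : ℝ))))) := by
  refine ⟨fun C₁ C₂ C h₁ h₁₂ hC => ?_, fun C hC => ?_⟩
  · have h₂ : 0 < C₂ := h₁.trans h₁₂
    obtain ⟨M, hM⟩ := pow_unbounded_of_one_lt (C₂ / C₁) one_lt_two
    have hP := powConst_pos h₁ (by linarith : 0 < C₂ + 2) (fun m => a + m) q
    refine ⟨(M + 1 : ℕ) * (powConst C₁ (C₂ + 2) (fun m => a + m) q * C), by positivity, ?_⟩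
    intro e he N hN K f hK hf hsupp hbd z k hk
    obtain rfl : K = fun z => ∑ n ∈ Finset.range (N + 1), f n z := funext hK
    exact weighted_bound_of_decomposition a q h₁ h₂ hC hM.le he.1 hN hf hsupp hbd z k hk
  · obtain ⟨R, C', hR, hC', h⟩ := exists_decomposition d a q hC
    refine ⟨1 / 2, R, C', one_half_pos, by linarith, hC', ?_⟩
    intro e he N hN K hK hKs hKC
    obtain ⟨f, hf, hsum, hhi, hlo, hbd⟩ := h he.1 hN hK hKs hKC
    exact ⟨f, fun n _ => hf n, hsum, fun n _ => hhi n, hlo, hbd⟩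
end
end
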